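/- arXiv:2601.20137 — 6 statements merged into one kernel-verified Lean document; each statement's English description precedes it below -/
import Mathlib

section
/- Let G = (V, E) be a finite simple graph. For i = 1, 2, …, |E|, let F_i = (V, E_i) be a maximal spanning forest of the graph (V, E ∖ (E_1 ∪ E_2 ∪ ⋯ ∪ E_{i−1})) (where possibly E_i = ∅ from some index onward), and let G_i = (V, E_1 ∪ E_2 ∪ ⋯ ∪ E_i). Then for every i and all vertices x, y ∈ V, λ(x, y; G_i) ≥ min{λ(x, y; G), i}. -/
/-- `G` contains `n` pairwise edge-disjoint `u`–`v` paths.  The local edge-connectivity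
`λ(u, v; G)` is the largest `n` for which this holds. -/
def HasEdgeDisjointPaths {V : Type*} (G : SimpleGraph V) (u v : V) (n : ℕ) : Prop :=
  ∃ P : Fin n → G.Path u v,
    ∀ i j, i ≠ j → ∀ e ∈ (P i).val.edges, e ∉ (P j).val.edges

/-- `F` is a maximal spanning forest of `H`: a spanning subgraph of `H` that is acyclic and
maximal with respect to edge inclusion among acyclic spanning subgraphs of `H`. -/
def IsMaximalSpanningForest {V : Type*} (H F : SimpleGraph V) : Prop :=
  F ≤ H ∧ F.IsAcyclic ∧
    ∀ F' : SimpleGraph V, F' ≤ H → F'.IsAcyclic → F ≤ F' → F' = F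

namespace SimpleGraph

open Finset

variable {V : Type*}

/-- A relation contained in the adjacency of `G` either contains a directed path from `x` to `y`,
or has a closed set containing `x` and not `y`. -/
lemma exists_isPath_or_exists_closed (G : SimpleGraph V) (r : V → V → Prop)
    (hr : ∀ a b, r a b → G.Adj a b) (x y : V) :
    (∃ p : G.Walk x y, p.IsPath ∧ ∀ d ∈ p.darts, r d.fst d.snd) ∨
      ∃ S : Set V, x ∈ S ∧ y ∉ S ∧ ∀ a ∈ S, ∀ b ∉ S, ¬ r a b := by
  classical
  by_cases h : Relation.ReflTransGen r x y
  · left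
    obtain ⟨p, hp⟩ : ∃ p : G.Walk x y, ∀ d ∈ p.darts, r d.fst d.snd := by
      induction h using Relation.ReflTransGen.head_induction_on with
      | refl => exact ⟨.nil, by simp⟩
      | head hab _ ih =>
        obtain ⟨p, hp⟩ := ih
        refine ⟨.cons (hr _ _ hab) p, ?_⟩
        simpa [hab] using hp
    exact ⟨p.bypass, p.bypass_isPath, fun d hd => hp d (p.darts_bypass_subset_darts hd)⟩
  · exact .inr ⟨{z | Relation.ReflTransGen r x z}, .refl, h,
      fun a ha b hb hab => hb (ha.tail hab)⟩

/-- A unit-capacity integral flow of value `k` from `x` to `y` in `G`, given by its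
antisymmetric net flow along ordered pairs of vertices. -/
structure IsUnitFlow [Fintype V] [DecidableEq V] (G : SimpleGraph V) (x y : V) (k : ℕ)
    (f : V → V → ℤ) : Prop where
  antisymm : ∀ a b, f b a = -f a b
  le_one : ∀ a b, f a b ≤ 1
  eq_zero : ∀ a b, ¬ G.Adj a b → f a b = 0
  excess : ∀ v, ∑ b, f v b = k * ((if v = x then 1 else 0) - if v = y then 1 else 0)

/-- The net number of times a walk traverses the ordered pair `(a, b)`. -/
def Walk.netFlow [DecidableEq V] {G : SimpleGraph V} {u v : V} (p : G.Walk u v) (a b : V) : ℤ :=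
  (p.darts.map fun d => (d.fst, d.snd)).count (a, b) -
    (p.darts.map fun d => (d.fst, d.snd)).count (b, a)

lemma Walk.sum_netFlow [Fintype V] [DecidableEq V] {G : SimpleGraph V} {u v : V}
    (p : G.Walk u v) (w : V) :
    ∑ b, p.netFlow w b = (if w = u then 1 else 0) - if w = v then 1 else 0 := by
  induction p with
  | nil => simp [netFlow]
  | @cons u v z h p ih =>
    have key : ∀ b, (Walk.cons h p).netFlow w b = p.netFlow w b +
        ((if w = u then if b = v then 1 else 0 else 0) -
          if w = v then if b = u then 1 else 0 else 0) := by
      intro b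
      simp only [netFlow, darts_cons, List.map_cons, List.count_cons, beq_iff_eq, Prod.mk.injEq]
      split_ifs <;> grind
    rw [sum_congr rfl fun b _ => key b, sum_add_distrib, ih, sum_sub_distrib]
    split_ifs <;> simp

/-- A path has net flow one along its darts, minus one along their reverses, and zero on all
other pairs. -/
lemma Walk.IsPath.netFlow_cases [DecidableEq V] {G : SimpleGraph V} {u v : V} {p : G.Walk u v}
    (hp : p.IsPath) (a b : V) :
    (p.netFlow a b = 1 ∧ ∃ d ∈ p.darts, d.fst = a ∧ d.snd = b) ∨
      (p.netFlow a b = -1 ∧ ∃ d ∈ p.darts, d.fst = b ∧ d.snd = a) ∨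
      (p.netFlow a b = 0 ∧ s(a, b) ∉ p.edges) := by
  induction p with
  | nil => simp [netFlow]
  | @cons u v z h p ih =>
    rw [cons_isPath_iff] at hp
    have key : (Walk.cons h p).netFlow a b = p.netFlow a b +
        ((if a = u ∧ b = v then 1 else 0) - if a = v ∧ b = u then 1 else 0) := by
      simp only [netFlow, darts_cons, List.map_cons, List.count_cons, beq_iff_eq, Prod.mk.injEq]
      split_ifs <;> grind
    have hne := h.ne
    have hnot : s(u, v) ∉ p.edges := fun hmem => hp.2 (p.fst_mem_support_of_mem_edges hmem)
    have hd : ∀ d ∈ p.darts, s(d.fst, d.snd) ∈ p.edges := fun d hd =>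
      List.mem_map_of_mem (f := Dart.edge) hd
    rw [key]
    simp only [darts_cons, List.mem_cons, exists_eq_or_imp, edges_cons]
    by_cases h1 : a = u ∧ b = v
    · obtain ⟨rfl, rfl⟩ := h1
      have := ih hp.1
      grind [Sym2.eq_swap]
    by_cases h2 : a = v ∧ b = u
    · obtain ⟨rfl, rfl⟩ := h2
      have := ih hp.1
      grind [Sym2.eq_swap]
    have := ih hp.1
    simp only [Sym2.eq_iff]
    grind

lemma Walk.netFlow_antisymm [DecidableEq V] {G : SimpleGraph V} {u v : V} (p : G.Walk u v)
    (a b : V) : p.netFlow b a = -p.netFlow a b := by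
  simp [netFlow]

lemma IsUnitFlow.sum_cut [Fintype V] [DecidableEq V] {G : SimpleGraph V} {x y : V} {k : ℕ}
    {f : V → V → ℤ} (hf : G.IsUnitFlow x y k f) {S : Finset V} (hx : x ∈ S) (hy : y ∉ S) :
    ∑ a ∈ S, ∑ b ∈ Sᶜ, f a b = k := by
  have h1 : ∑ a ∈ S, ∑ b, f a b = k := by
    rw [sum_congr rfl fun v _ => hf.excess v, ← mul_sum, sum_sub_distrib]
    simp [hx, hy]
  have h2 : ∑ a ∈ S, ∑ b ∈ S, f a b = 0 := by
    have : ∑ a ∈ S, ∑ b ∈ S, f a b = -∑ a ∈ S, ∑ b ∈ S, f a b := by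
      conv_lhs => rw [sum_comm]
      simp only [← sum_neg_distrib, ← hf.antisymm]
    omega
  rw [← h1, ← zero_add (∑ a ∈ S, ∑ b ∈ Sᶜ, f a b), ← h2, ← sum_add_distrib]
  simp only [sum_add_sum_compl]

lemma IsUnitFlow.hasEdgeDisjointPaths [Fintype V] [DecidableEq V] {G : SimpleGraph V} {x y : V}
    {k : ℕ} {f : V → V → ℤ} (hf : G.IsUnitFlow x y k f) :
    ∃ P : Fin k → G.Path x y,
      (∀ i j, i ≠ j → ∀ e ∈ (P i).val.edges, e ∉ (P j).val.edges) ∧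
      ∀ i, ∀ d ∈ (P i).val.darts, f d.fst d.snd = 1 := by
  classical
  induction k generalizing f with
  | zero => exact ⟨Fin.elim0, fun i => i.elim0, fun i => i.elim0⟩
  | succ k ih =>
    obtain ⟨p, hp, hpf⟩ | ⟨S, hx, hy, hS⟩ :=
      G.exists_isPath_or_exists_closed (fun a b => f a b = 1)
        (fun a b h => by by_contra hab; simp [hf.eq_zero a b hab] at h) x y
    · have hpf' : ∀ d ∈ p.darts, f d.snd d.fst = -1 := fun d hd => by
        rw [hf.antisymm, hpf d hd]
      have hf' : G.IsUnitFlow x y k (fun a b => f a b - p.netFlow a b) := by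
        refine ⟨fun a b => ?_, fun a b => ?_, fun a b hab => ?_, fun v => ?_⟩
        · rw [hf.antisymm, p.netFlow_antisymm]; ring
        · have := hf.le_one a b
          obtain ⟨h, d, hd, rfl, rfl⟩ | ⟨h, d, hd, rfl, rfl⟩ | ⟨h, -⟩ := hp.netFlow_cases a b
          · omega
          · have := hpf' d hd
            omega
          · omega
        · have := hf.eq_zero a b hab
          obtain ⟨h, d, hd, rfl, rfl⟩ | ⟨h, d, hd, rfl, rfl⟩ | ⟨h, -⟩ := hp.netFlow_cases a b
          · exact absurd d.adj hab
          · exact absurd d.adj.symm hab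
          · omega
        · rw [sum_sub_distrib, hf.excess, p.sum_netFlow]
          push_cast
          ring
      obtain ⟨P, hP, hPf⟩ := ih hf'
      have hdisj : ∀ i, ∀ e ∈ (P i).val.edges, e ∉ p.edges := by
        intro i e he hep
        obtain ⟨d, hd, rfl⟩ := List.mem_map.1 he
        have h1 := hPf i d hd
        obtain ⟨h, d', hd', h3, h4⟩ | ⟨h, d', hd', h3, h4⟩ | ⟨h, h'⟩ :=
          hp.netFlow_cases d.fst d.snd
        · have := hpf d' hd'
          rw [h3, h4] at this
          omega
        · have := hpf' d' hd'
          rw [h3, h4] at this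
          omega
        · exact h' hep
      refine ⟨Fin.cons ⟨p, hp⟩ P, ?_, ?_⟩
      · intro i j hij
        cases i using Fin.cases <;> cases j using Fin.cases
        · exact absurd rfl hij
        · simpa using fun e he he' => hdisj _ e he' he
        · simpa using hdisj _
        · simpa using hP _ _ (by simpa using hij)
      · intro i
        cases i using Fin.cases with
        | zero => simpa using hpf
        | succ i =>
          intro d hd
          simp only [Fin.cons_succ] at hd
          have h1 := hPf i d hd
          obtain ⟨h, d', hd', h3, h4⟩ | ⟨h, d', hd', h3, h4⟩ | ⟨h, h'⟩ :=
            hp.netFlow_cases d.fst d.snd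
          · rw [← h3, ← h4]
            exact hpf d' hd'
          · have := hpf' d' hd'
            rw [h3, h4] at this
            omega
          · omega
    · have h1 := hf.sum_cut (S := S.toFinset) (by simpa) (by simpa)
      have h2 : ∑ a ∈ S.toFinset, ∑ b ∈ S.toFinsetᶜ, f a b ≤ 0 :=
        sum_nonpos fun a ha => sum_nonpos fun b hb => by
          have := hS a (by simpa using ha) b (by simpa using hb)
          have := hf.le_one a b
          omega
      push_cast at h1
      omega

/-- If every edge cut separating `x` from `y` has at least `n` edges, then `G` carries a flow of
value `n` from `x` to `y`. -/
lemma exists_isUnitFlow [Fintype V] [DecidableEq V] (G : SimpleGraph V) [DecidableRel G.Adj]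
    (x y : V) (n : ℕ)
    (hcut : ∀ S : Finset V, x ∈ S → y ∉ S →
      n ≤ #{d ∈ S ×ˢ Sᶜ | G.Adj d.1 d.2}) :
    ∃ f, G.IsUnitFlow x y n f := by
  classical
  induction n with
  | zero => exact ⟨fun _ _ => 0, by simp, by simp, by simp, by simp⟩
  | succ n ih =>
    obtain ⟨f, hf⟩ := ih fun S hx hy => (Nat.le_succ n).trans (hcut S hx hy)
    obtain ⟨p, hp, hpf⟩ | ⟨S, hx, hy, hS⟩ :=
      G.exists_isPath_or_exists_closed (fun a b => G.Adj a b ∧ f a b < 1) (fun a b h => h.1) x y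
    · refine ⟨fun a b => f a b + p.netFlow a b, fun a b => ?_, fun a b => ?_, fun a b hab => ?_,
        fun v => ?_⟩
      · rw [hf.antisymm, p.netFlow_antisymm]; ring
      · have := hf.le_one a b
        obtain ⟨h, d, hd, rfl, rfl⟩ | ⟨h, d, hd, rfl, rfl⟩ | ⟨h, -⟩ := hp.netFlow_cases a b
        · have := (hpf d hd).2
          omega
        · omega
        · omega
      · have := hf.eq_zero a b hab
        obtain ⟨h, d, hd, rfl, rfl⟩ | ⟨h, d, hd, rfl, rfl⟩ | ⟨h, -⟩ := hp.netFlow_cases a b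
        · exact absurd d.adj hab
        · exact absurd d.adj.symm hab
        · omega
      · rw [sum_add_distrib, hf.excess, p.sum_netFlow]
        push_cast
        ring
    · have h1 := hf.sum_cut (S := S.toFinset) (by simpa) (by simpa)
      have h2 : ∑ a ∈ S.toFinset, ∑ b ∈ S.toFinsetᶜ, f a b =
          #{d ∈ S.toFinset ×ˢ S.toFinsetᶜ | G.Adj d.1 d.2} := by
        rw [← sum_product', card_filter, Nat.cast_sum]
        refine sum_congr rfl fun d hd => ?_
        rw [mem_product] at hd
        have h3 := hS d.1 (by simpa using hd.1) d.2 (by simpa using hd.2)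
        have h4 := hf.le_one d.1 d.2
        have h5 := hf.eq_zero d.1 d.2
        split_ifs with h
        · have : ¬ f d.1 d.2 < 1 := fun h' => h3 ⟨h, h'⟩
          push_cast
          omega
        · simpa using h5 h
      have := hcut S.toFinset (by simpa) (by simpa)
      omega

/-- Edge-disjoint families of walks joining the two sides of a cut bound its size from below. -/
lemma le_card_cut [Fintype V] [DecidableEq V] {ι : Type*} [Fintype ι] (G : SimpleGraph V)
    [DecidableRel G.Adj] (S : Finset V) (E : ι → Set (Sym2 V))
    (hE : ∀ i j, i ≠ j → Disjoint (E i) (E j))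
    (h : ∀ i, ∃ a ∈ S, ∃ b ∉ S, G.Adj a b ∧ s(a, b) ∈ E i) :
    Fintype.card ι ≤ #{d ∈ S ×ˢ Sᶜ | G.Adj d.1 d.2} := by
  choose a ha b hb hab hmem using h
  rw [← card_univ]
  refine card_le_card_of_injOn (fun i => (a i, b i)) (fun i _ => ?_) fun i _ j _ hij => ?_
  · simp [ha, hb, hab]
  · by_contra hne
    simp only [Prod.mk.injEq] at hij
    refine Set.disjoint_left.1 (hE i j hne) (hmem i) ?_
    rw [hij.1, hij.2]
    exact hmem j

lemma Walk.exists_cut_edge {G : SimpleGraph V} {x y : V} (p : G.Walk x y) (S : Finset V)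
    (hx : x ∈ S) (hy : y ∉ S) : ∃ a ∈ S, ∃ b ∉ S, G.Adj a b ∧ s(a, b) ∈ p.edges := by
  obtain ⟨d, hd, h1, h2⟩ := p.exists_boundary_dart S hx hy
  exact ⟨d.fst, h1, d.snd, h2, d.adj, List.mem_map_of_mem (f := Dart.edge) hd⟩

end SimpleGraph

open SimpleGraph

lemma IsMaximalSpanningForest.reachable {V : Type*} {H F : SimpleGraph V}
    (h : IsMaximalSpanningForest H F) {a b : V} (hab : H.Adj a b) : F.Reachable a b := by
  rw [reachable_eq_of_maximal_isAcyclic F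
    ⟨⟨h.1, h.2.1⟩, fun F' hF' hle => (h.2.2 F' hF'.1 hF'.2 hle).le⟩]
  exact hab.reachable

/-- (Nagamochi–Ibaraki) Let `G` be a finite simple graph and, for `i = 1, …, |E|`, let
`F i` be a maximal spanning forest of `G` minus the edges of the previous forests.
Then for each such `i`, the graph `G_i = F 1 ∪ ⋯ ∪ F i` satisfies
`λ(x, y; G_i) ≥ min (λ(x, y; G), i)` for all `x, y ∈ V`; equivalently, whenever `G` has `n`
pairwise edge-disjoint `x`–`y` paths, `G_i` has `min n i` of them. -/
theorem sparse_certificate {V : Type*} [Fintype V] (G : SimpleGraph V)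
    (F : ℕ → SimpleGraph V)
    (hF : ∀ i, 1 ≤ i → i ≤ G.edgeSet.ncard →
      IsMaximalSpanningForest (G \ (⨆ j ∈ Finset.Ico 1 i, F j)) (F i)) :
    ∀ i, 1 ≤ i → i ≤ G.edgeSet.ncard → ∀ x y : V, ∀ n : ℕ,
      HasEdgeDisjointPaths G x y n →
      HasEdgeDisjointPaths (⨆ j ∈ Finset.Icc 1 i, F j) x y (min n i) := by
  classical
  intro i _ hi x y n ⟨P, hP⟩
  obtain rfl | hxy := eq_or_ne x y
  · exact ⟨fun _ => Path.nil, by simp⟩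
  set K := ⨆ j ∈ Finset.Icc 1 i, F j with hK
  have hadj : ∀ {a b}, K.Adj a b ↔ ∃ j ∈ Finset.Icc 1 i, (F j).Adj a b := by
    simp [hK, iSup_adj]
  obtain ⟨f, hf⟩ := K.exists_isUnitFlow x y (min n i) fun S hx hy => by
    by_cases hcut : ∀ a ∈ S, ∀ b ∉ S, G.Adj a b → K.Adj a b
    · refine (min_le_left n i).trans ?_
      simpa using K.le_card_cut S (fun t => {e | e ∈ (P t).val.edges})
        (fun s t hst => Set.disjoint_left.2 (hP s t hst)) fun t => by
          obtain ⟨a, ha, b, hb, hab, hmem⟩ := (P t).val.exists_cut_edge S hx hy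
          exact ⟨a, ha, b, hb, hcut a ha b hb hab, hmem⟩
    · push Not at hcut
      obtain ⟨a, ha, b, hb, hab, hnot⟩ := hcut
      have hdisj : ∀ s ∈ Finset.Icc 1 i, ∀ t ∈ Finset.Icc 1 i, s < t →
          Disjoint (F s).edgeSet (F t).edgeSet := by
        intro s hs t ht hst
        rw [Finset.mem_Icc] at hs ht
        rw [disjoint_edgeSet]
        refine Disjoint.mono_right (hF t ht.1 (ht.2.trans hi)).1 ?_
        exact disjoint_sdiff_self_right.mono_left
          (le_iSup₂_of_le s (Finset.mem_Ico.2 ⟨hs.1, hst⟩) le_rfl)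
      refine (min_le_right n i).trans ?_
      have := K.le_card_cut S (fun t : Finset.Icc 1 i => (F t).edgeSet)
        (fun s t hst => by
          obtain h | h := lt_or_gt_of_ne (Subtype.coe_injective.ne hst)
          · exact hdisj s s.2 t t.2 h
          · exact (hdisj t t.2 s s.2 h).symm) fun t => by
          have ht := Finset.mem_Icc.1 t.2
          have hH : (G \ ⨆ j ∈ Finset.Ico 1 t.1, F j).Adj a b := by
            refine ⟨hab, fun h => hnot ?_⟩
            simp only [iSup_adj, Finset.mem_Ico, exists_prop] at h
            obtain ⟨j, hj, h⟩ := h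
            exact hadj.2 ⟨j, Finset.mem_Icc.2 ⟨hj.1, hj.2.le.trans ht.2⟩, h⟩
          obtain ⟨p⟩ := (hF t ht.1 (ht.2.trans hi)).reachable hH
          obtain ⟨c, hc, d, hd, hcd, -⟩ := p.exists_cut_edge S ha hb
          exact ⟨c, hc, d, hd, hadj.2 ⟨t, t.2, hcd⟩, hcd⟩
      simpa using this
  obtain ⟨Q, hQ, -⟩ := hf.hasEdgeDisjointPaths
  exact ⟨Q, hQ⟩
end

section
/- Let G = (V, E) be a finite simple graph. For i = 1, 2, …, k, let F_i = (V, E_i) be a maximal spanning forest of the graph (V, E ∖ (E_1 ∪ E_2 ∪ ⋯ ∪ E_{i−1})), and let G_k = (V, E_1 ∪ E_2 ∪ ⋯ ∪ E_k). If k ≤ λ(G), then G_k is k-edge-connected, i.e., λ(G_k) ≥ k. -/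
namespace SimpleGraph

variable {V : Type*} {G : SimpleGraph V}

/-- An integral flow of value `n` from `u` to `v` in which every edge of `G` has capacity one. -/
structure IsUnitFlow_s3 [Fintype V] [DecidableEq V] (G : SimpleGraph V) (u v : V) (n : ℕ)
    (f : V → V → ℤ) : Prop where
  antisymm : ∀ a b, f a b = -f b a
  le_one : ∀ a b, f a b ≤ 1
  adj : ∀ a b, f a b ≠ 0 → G.Adj a b
  sum_eq : ∀ a, ∑ b, f a b = n * ((if a = u then 1 else 0) - (if a = v then 1 else 0))

/-- Every edge cut separating `u` from `v` contains at least `n` edges, in the sense that `n`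
distinct darts leave the side of `u`. -/
def HasLargeCuts (G : SimpleGraph V) (u v : V) (n : ℕ) : Prop :=
  ∀ S : Set V, u ∈ S → v ∉ S → ∃ d : Fin n → V × V, Function.Injective d ∧
    ∀ i, (d i).1 ∈ S ∧ (d i).2 ∉ S ∧ G.Adj (d i).1 (d i).2

theorem exists_walk_of_reflTransGen {r : V → V → Prop} (hr : ∀ a b, r a b → G.Adj a b) {u v : V}
    (h : Relation.ReflTransGen r u v) : ∃ p : G.Walk u v, ∀ d ∈ p.darts, r d.fst d.snd := by
  induction h using Relation.ReflTransGen.head_induction_on with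
  | refl => exact ⟨.nil, by simp⟩
  | head hab _ ih =>
    obtain ⟨p, hp⟩ := ih
    exact ⟨.cons (hr _ _ hab) p, by simpa [hab] using hp⟩

theorem exists_path_of_reflTransGen {r : V → V → Prop} (hr : ∀ a b, r a b → G.Adj a b) {u v : V}
    (h : Relation.ReflTransGen r u v) : ∃ p : G.Path u v, ∀ d ∈ p.val.darts, r d.fst d.snd := by
  classical
  obtain ⟨p, hp⟩ := exists_walk_of_reflTransGen hr h
  exact ⟨p.toPath, fun d hd => hp d (p.darts_toPath_subset_darts hd)⟩

theorem Walk.mem_edges_cases {u v a b : V} {p : G.Walk u v} (h : s(a, b) ∈ p.edges) :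
    (∃ d ∈ p.darts, d.fst = a ∧ d.snd = b) ∨ ∃ d ∈ p.darts, d.fst = b ∧ d.snd = a := by
  obtain ⟨d, hd, he⟩ := List.mem_map.1 h
  rcases Sym2.eq_iff.1 (show s(d.fst, d.snd) = s(a, b) from he) with h | h
  · exact .inl ⟨d, hd, h⟩
  · exact .inr ⟨d, hd, h⟩

section Flow

variable [Fintype V] [DecidableEq V] {u v : V} {n : ℕ} {f : V → V → ℤ}

theorem Walk.IsPath.exists_flow {p : G.Walk u v} (hp : p.IsPath) :
    ∃ g : V → V → ℤ, (∀ a b, g a b = -g b a) ∧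
      (∀ a, ∑ b, g a b = (if a = u then 1 else 0) - (if a = v then 1 else 0)) ∧
      (∀ d ∈ p.darts, g d.fst d.snd = 1) ∧ ∀ a b, s(a, b) ∉ p.edges → g a b = 0 := by
  induction p with
  | nil => exact ⟨fun _ _ => 0, by simp⟩
  | @cons x y z h q ih =>
    obtain ⟨hq, hx⟩ := (Walk.cons_isPath_iff h q).1 hp
    obtain ⟨g, hanti, hsum, hone, hzero⟩ := ih hq
    have hnot : ∀ w, s(x, w) ∉ q.edges := fun w hw => hx (q.fst_mem_support_of_mem_edges hw)
    have hne : x ≠ y := h.ne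
    refine ⟨fun a b => g a b + (if a = x then if b = y then 1 else 0 else 0)
      - (if a = y then if b = x then 1 else 0 else 0), ?_, ?_, ?_, ?_⟩
    · intro a b
      have := hanti a b
      grind
    · intro a
      have := hsum a
      simp only [Finset.sum_sub_distrib, Finset.sum_add_distrib, this]
      by_cases h1 : a = x <;> by_cases h2 : a = y <;> simp [h1, h2] <;> ring
    · intro d hd
      rw [Walk.darts_cons, List.mem_cons] at hd
      rcases hd with rfl | hd
      · have := hzero x y (hnot y)
        simp [this, hne]
      · have h1 : d.fst ≠ x := by
          rintro rfl
          exact hx (q.dart_fst_mem_support_of_mem_darts hd)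
        have h2 : d.snd ≠ x := by
          rintro rfl
          exact hx (q.dart_snd_mem_support_of_mem_darts hd)
        simp [hone d hd, h1, h2]
    · intro a b hab
      rw [Walk.edges_cons, List.mem_cons, not_or] at hab
      have := hzero a b hab.2
      have h1 := hab.1
      rw [Sym2.eq_iff] at h1
      grind

theorem IsUnitFlow_s3.sum_crossing_eq (hf : G.IsUnitFlow_s3 u v n f) {S : Finset V} (hu : u ∈ S)
    (hv : v ∉ S) : ∑ a ∈ S, ∑ b ∈ Sᶜ, f a b = n := by
  have hin : ∑ a ∈ S, ∑ b ∈ S, f a b = 0 := by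
    have h : ∑ a ∈ S, ∑ b ∈ S, f a b = -∑ a ∈ S, ∑ b ∈ S, f a b := by
      conv_lhs => rw [Finset.sum_comm]
      simp only [← Finset.sum_neg_distrib]
      exact Finset.sum_congr rfl fun a _ => Finset.sum_congr rfl fun b _ => hf.antisymm b a
    linarith
  have hall : ∑ a ∈ S, ∑ b, f a b = n := by
    simp [hf.sum_eq, ← Finset.mul_sum, Finset.sum_sub_distrib, hu, hv]
  rw [← hall, ← zero_add (∑ a ∈ S, ∑ b ∈ Sᶜ, f a b), ← hin, ← Finset.sum_add_distrib]
  exact Finset.sum_congr rfl fun a _ => Finset.sum_add_sum_compl S _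

theorem IsUnitFlow_s3.exists_disjoint_paths (hf : G.IsUnitFlow_s3 u v n f) :
    ∃ P : Fin n → G.Path u v, (∀ i j, i ≠ j → ∀ e ∈ (P i).val.edges, e ∉ (P j).val.edges) ∧
      ∀ i a b, s(a, b) ∈ (P i).val.edges → f a b ≠ 0 := by
  classical
  induction n generalizing f with
  | zero => exact ⟨Fin.elim0, fun i => i.elim0, fun i => i.elim0⟩
  | succ n ih =>
    have hreach : Relation.ReflTransGen (fun a b => f a b = 1) u v := by
      by_contra hv
      let S : Finset V := {w | Relation.ReflTransGen (fun a b => f a b = 1) u w}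
      have hsum := hf.sum_crossing_eq (S := S) (by simp [S, Relation.ReflTransGen.refl])
        (by simpa [S] using hv)
      have hle : ∑ a ∈ S, ∑ b ∈ Sᶜ, f a b ≤ 0 := by
        refine Finset.sum_nonpos fun a ha => Finset.sum_nonpos fun b hb => ?_
        by_contra hpos
        have hab : f a b = 1 := by have := hf.le_one a b; omega
        simp only [S, Finset.mem_compl, Finset.mem_filter_univ] at ha hb
        exact hb (ha.tail hab)
      push_cast at hsum
      omega
    obtain ⟨p, hp⟩ := exists_path_of_reflTransGen (G := G) (r := fun a b => f a b = 1)
      (fun a b hab => hf.adj a b (by omega)) hreach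
    obtain ⟨g, hanti, hsum, hone, hzero⟩ := p.prop.exists_flow
    have hcase : ∀ a b, s(a, b) ∈ p.val.edges ∧ f a b ≠ 0 ∧ g a b = f a b ∨
        s(a, b) ∉ p.val.edges ∧ g a b = 0 := by
      intro a b
      by_cases h : s(a, b) ∈ p.val.edges
      · refine .inl ⟨h, ?_⟩
        rcases Walk.mem_edges_cases h with ⟨d, hd, rfl, rfl⟩ | ⟨d, hd, rfl, rfl⟩
        · have := hone d hd
          have := hp d hd
          omega
        · have := hone d hd
          have := hp d hd
          have := hanti d.fst d.snd
          have := hf.antisymm d.fst d.snd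
          omega
      · exact .inr ⟨h, hzero a b h⟩
    have hflow : G.IsUnitFlow_s3 u v n (fun a b => f a b - g a b) := by
      refine ⟨fun a b => ?_, fun a b => ?_, fun a b hab => hf.adj a b ?_, fun a => ?_⟩
      · have := hanti a b
        have := hf.antisymm a b
        omega
      · have := hf.le_one a b
        have := hcase a b
        omega
      · have := hcase a b
        omega
      · rw [Finset.sum_sub_distrib, hf.sum_eq, hsum]
        push_cast
        ring
    obtain ⟨P, hP, hP0⟩ := ih hflow
    have hdisj : ∀ i, ∀ e ∈ (P i).val.edges, e ∉ p.val.edges := by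
      intro i e
      induction e using Sym2.ind with
      | _ a b =>
        intro h h'
        have h1 := hP0 i a b h
        have h2 := hcase a b
        simp only [h', not_true_eq_false, false_and, or_false, true_and] at h2
        omega
    refine ⟨Fin.cons p P, ?_, ?_⟩
    · intro i j
      refine Fin.cases ?_ (fun i => ?_) i <;> refine Fin.cases ?_ (fun j => ?_) j
      · simp
      · intro _ e he he'
        exact hdisj j e he' he
      · intro _ e he he'
        exact hdisj i e he he'
      · intro hij
        exact hP i j fun h => hij (h ▸ rfl)
    · intro i a b
      refine Fin.cases (fun h => ?_) (fun i h => ?_) i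
      · have := hcase a b
        simp only [Fin.cons_zero] at h
        simp only [h, not_true_eq_false, false_and, or_false, true_and] at this
        exact this.1
      · have h1 := hP0 i a b h
        have h2 := hcase a b
        omega

theorem IsUnitFlow_s3.exists_succ (hf : G.IsUnitFlow_s3 u v n f) {k : ℕ} (hcut : G.HasLargeCuts u v k)
    (hn : n < k) : ∃ f', G.IsUnitFlow_s3 u v (n + 1) f' := by
  classical
  have hreach : Relation.ReflTransGen (fun a b => G.Adj a b ∧ f a b ≤ 0) u v := by
    by_contra hv
    let S : Finset V := {w | Relation.ReflTransGen (fun a b => G.Adj a b ∧ f a b ≤ 0) u w}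
    have hu : u ∈ S := by simp [S, Relation.ReflTransGen.refl]
    have hv : v ∉ S := by simpa [S] using hv
    have hsum := hf.sum_crossing_eq hu hv
    obtain ⟨d, hinj, hd⟩ := hcut S (by simpa using hu) (by simpa using hv)
    have hfull : ∀ a ∈ S, ∀ b ∈ Sᶜ, G.Adj a b → f a b = 1 := by
      intro a ha b hb hab
      by_contra hne
      have hle : f a b ≤ 0 := by have := hf.le_one a b; omega
      simp only [S, Finset.mem_compl, Finset.mem_filter_univ] at ha hb
      exact hb (ha.tail ⟨hab, hle⟩)
    have hge : (k : ℤ) ≤ ∑ x ∈ S ×ˢ Sᶜ, f x.1 x.2 := by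
      have himg : Finset.univ.image d ⊆ S ×ˢ Sᶜ := by
        intro x hx
        obtain ⟨i, -, rfl⟩ := Finset.mem_image.1 hx
        have := hd i
        simp_all
      calc (k : ℤ) = ∑ i, f (d i).1 (d i).2 := by
            rw [Finset.sum_congr rfl fun i _ => hfull _ (by simpa using (hd i).1) _
              (by simpa using (hd i).2.1) (hd i).2.2]
            simp
        _ = ∑ x ∈ Finset.univ.image d, f x.1 x.2 := by
            rw [Finset.sum_image fun i _ j _ h => hinj h]
        _ ≤ _ := by
            refine Finset.sum_le_sum_of_subset_of_nonneg himg fun x hx _ => ?_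
            obtain ⟨h1, h2⟩ := Finset.mem_product.1 hx
            by_cases h : f x.1 x.2 = 0
            · exact h.ge
            · rw [hfull _ h1 _ h2 (hf.adj _ _ h)]
              exact zero_le_one
    rw [Finset.sum_product, hsum] at hge
    omega
  obtain ⟨p, hp⟩ := exists_path_of_reflTransGen (G := G) (fun a b hab => hab.1) hreach
  obtain ⟨g, hanti, hsum, hone, hzero⟩ := p.prop.exists_flow
  refine ⟨fun a b => f a b + g a b, fun a b => ?_, fun a b => ?_, fun a b hab => ?_, fun a => ?_⟩
  · have := hanti a b
    have := hf.antisymm a b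
    omega
  · by_cases h : s(a, b) ∈ p.val.edges
    · rcases Walk.mem_edges_cases h with ⟨d, hd, rfl, rfl⟩ | ⟨d, hd, rfl, rfl⟩
      · have := hone d hd
        have := (hp d hd).2
        omega
      · have := hone d hd
        have := hanti d.fst d.snd
        have := hf.le_one d.snd d.fst
        omega
    · have := hzero a b h
      have := hf.le_one a b
      omega
  · by_cases h : s(a, b) ∈ p.val.edges
    · exact p.val.adj_of_mem_edges h
    · have := hzero a b h
      exact hf.adj a b (by omega)
  · rw [Finset.sum_add_distrib, hf.sum_eq, hsum]
    push_cast
    ring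

theorem HasLargeCuts.exists_isUnitFlow {k : ℕ} (hcut : G.HasLargeCuts u v k) :
    ∃ f, G.IsUnitFlow_s3 u v k f := by
  suffices h : ∀ n ≤ k, ∃ f, G.IsUnitFlow_s3 u v n f from h k le_rfl
  intro n
  induction n with
  | zero => exact fun _ => ⟨fun _ _ => 0, by constructor <;> simp⟩
  | succ n ih =>
    intro hn
    obtain ⟨f, hf⟩ := ih (by omega)
    exact hf.exists_succ hcut hn

end Flow

/-- The edge version of Menger's theorem. -/
theorem HasLargeCuts.hasEdgeDisjointPaths [Fintype V] {u v : V} {k : ℕ}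
    (hcut : G.HasLargeCuts u v k) : HasEdgeDisjointPaths G u v k := by
  classical
  obtain ⟨f, hf⟩ := hcut.exists_isUnitFlow
  obtain ⟨P, hP, -⟩ := hf.exists_disjoint_paths
  exact ⟨P, hP⟩

theorem _root_.HasEdgeDisjointPaths.hasLargeCuts {u v : V} {k : ℕ}
    (h : HasEdgeDisjointPaths G u v k) : G.HasLargeCuts u v k := by
  intro S hu hv
  obtain ⟨P, hP⟩ := h
  choose d hd using fun i => (P i).val.exists_boundary_dart S hu hv
  refine ⟨fun i => (d i).toProd, fun i j hij => ?_, fun i => ⟨(hd i).2.1, (hd i).2.2, (d i).adj⟩⟩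
  by_contra hne
  have hdij : d i = d j := Dart.toProd_injective hij
  exact hP i j hne (d i).edge (List.mem_map_of_mem (hd i).1)
    (hdij ▸ List.mem_map_of_mem (hd j).1)

theorem _root_.IsMaximalSpanningForest.reachable_of_adj {H F : SimpleGraph V}
    (h : IsMaximalSpanningForest H F) {a b : V} (hab : H.Adj a b) : F.Reachable a b := by
  have hmax : Maximal (fun F' => F' ≤ H ∧ F'.IsAcyclic) F :=
    ⟨⟨h.1, h.2.1⟩, fun F' hF' hle => (h.2.2 F' hF'.1 hF'.2 hle).le⟩
  rw [reachable_eq_of_maximal_isAcyclic F hmax]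
  exact hab.reachable

end SimpleGraph

/-- Let `G` be a finite simple graph and, for `i = 1, …, k`, let `F i` be a maximal spanning
forest of `G` minus the edges of the previous forests, and let `G_k = F 1 ∪ ⋯ ∪ F k`.
If `k ≤ λ(G)` (every pair of distinct vertices of `G` is joined by `k` pairwise
edge-disjoint paths), then `G_k` is `k`-edge-connected, i.e. `λ(G_k) ≥ k`. -/
theorem sparse_certificate_k_edge_connected {V : Type*} [Fintype V]
    (G : SimpleGraph V) (k : ℕ) (F : ℕ → SimpleGraph V)
    (hF : ∀ i, 1 ≤ i → i ≤ k →
      IsMaximalSpanningForest (G \ (⨆ j ∈ Finset.Ico 1 i, F j)) (F i))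
    (hG : ∀ x y : V, x ≠ y → HasEdgeDisjointPaths G x y k) :
    ∀ x y : V, x ≠ y → HasEdgeDisjointPaths (⨆ j ∈ Finset.Icc 1 k, F j) x y k := by
  intro x y hxy
  refine SimpleGraph.HasLargeCuts.hasEdgeDisjointPaths fun S hx hy => ?_
  have hmem : ∀ i : Fin k, (i : ℕ) + 1 ∈ Finset.Icc 1 k := fun i => by
    rw [Finset.mem_Icc]
    omega
  by_cases hall : ∀ a ∈ S, ∀ b ∉ S, G.Adj a b → (⨆ j ∈ Finset.Icc 1 k, F j).Adj a b
  · obtain ⟨d, hinj, hd⟩ := (hG x y hxy).hasLargeCuts S hx hy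
    exact ⟨d, hinj, fun i => ⟨(hd i).1, (hd i).2.1, hall _ (hd i).1 _ (hd i).2.1 (hd i).2.2⟩⟩
  · push Not at hall
    obtain ⟨a, ha, b, hb, hab, hnot⟩ := hall
    simp only [SimpleGraph.iSup_adj, not_exists] at hnot
    have hforest : ∀ i : Fin k, ∃ d : V × V, d.1 ∈ S ∧ d.2 ∉ S ∧ (F (i + 1)).Adj d.1 d.2 := by
      intro i
      have hi := Finset.mem_Icc.1 (hmem i)
      have hadj : (G \ ⨆ j ∈ Finset.Ico 1 ((i : ℕ) + 1), F j).Adj a b := by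
        simp only [SimpleGraph.sdiff_adj, SimpleGraph.iSup_adj, not_exists]
        refine ⟨hab, fun j hj => hnot j ?_⟩
        rw [Finset.mem_Ico] at hj
        rw [Finset.mem_Icc]
        omega
      obtain ⟨p⟩ := (hF _ hi.1 hi.2).reachable_of_adj hadj
      obtain ⟨d, -, h1, h2⟩ := p.exists_boundary_dart S ha hb
      exact ⟨d.toProd, h1, h2, d.adj⟩
    choose d hd using hforest
    have hdisj : ∀ i j : Fin k, i < j → d i ≠ d j := by
      intro i j hij heq
      have hj := Finset.mem_Icc.1 (hmem j)
      have h := (hF _ hj.1 hj.2).1 (hd j).2.2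
      rw [← heq, SimpleGraph.sdiff_adj] at h
      refine h.2 ?_
      simp only [SimpleGraph.iSup_adj]
      exact ⟨i + 1, by rw [Finset.mem_Ico]; omega, (hd i).2.2⟩
    refine ⟨d, fun i j hij => ?_, fun i => ⟨(hd i).1, (hd i).2.1, ?_⟩⟩
    · by_contra hne
      rcases lt_or_gt_of_ne hne with h | h
      · exact hdisj i j h hij
      · exact hdisj j i h hij.symm
    · simp only [SimpleGraph.iSup_adj]
      exact ⟨i + 1, hmem i, (hd i).2.2⟩
end

section
/- Let G = (V, E) be a finite simple graph. For i = 1, 2, …, k, let F_i = (V, E_i) be a maximal spanning forest of the graph (V, E ∖ (E_1 ∪ E_2 ∪ ⋯ ∪ E_{i−1})). If vertices u, v ∈ V are connected in the forest F_k, then u and v are connected in every preceding forest F_j for all 1 ≤ j < k. -/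
/-- A maximal spanning forest of `H` has the same reachability relation as `H`. -/
theorem IsMaximalSpanningForest.reachable_eq {V : Type*} {H F : SimpleGraph V}
    (h : IsMaximalSpanningForest H F) : F.Reachable = H.Reachable :=
  H.reachable_eq_of_maximal_isAcyclic F
    ⟨⟨h.1, h.2.1⟩, fun F' hF' hle => (h.2.2 F' hF'.1 hF'.2 hle).le⟩

/-- Let `G` be a finite simple graph and, for `i = 1, …, k`, let `F i` be a maximal spanning
forest of `G` minus the edges of the previous forests.  If two vertices `u, v` are connected
in the forest `F k`, then they are connected in every preceding forest `F j`, `1 ≤ j < k`. -/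
theorem connected_in_last_forest_connected_in_all {V : Type*} [Fintype V]
    (G : SimpleGraph V) (k : ℕ) (F : ℕ → SimpleGraph V)
    (hF : ∀ i, 1 ≤ i → i ≤ k →
      IsMaximalSpanningForest (G \ (⨆ j ∈ Finset.Ico 1 i, F j)) (F i))
    (u v : V) (h : (F k).Reachable u v) :
    ∀ j, 1 ≤ j → j < k → (F j).Reachable u v := by
  intro j hj hjk
  have hle : F k ≤ G \ (⨆ i ∈ Finset.Ico 1 j, F i) :=
    (hF k (hj.trans hjk.le) le_rfl).1.trans <| sdiff_le_sdiff_left <|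
      biSup_mono fun _ hi => Finset.Ico_subset_Ico_right hjk.le hi
  rw [(hF j hj hjk.le).reachable_eq]
  exact h.mono hle
end

section
/- Let G = (V, E) be a finite simple graph. For i = 1, 2, …, k, let F_i = (V, E_i) be a maximal spanning forest of the graph (V, E ∖ (E_1 ∪ E_2 ∪ ⋯ ∪ E_{i−1})), and let G' = (V, E_1 ∪ E_2 ∪ ⋯ ∪ E_k). If vertices u, v ∈ V are connected in the forest F_k, then G' contains at least k pairwise edge-disjoint u–v paths, i.e., λ(u, v; G') ≥ k. -/
/-- Pairwise disjoint subgraphs of `G`, each of which connects `u` to `v`, give pairwise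
edge-disjoint `u`–`v` paths in `G`. -/
theorem HasEdgeDisjointPaths.of_pairwise_disjoint {V : Type*} {G : SimpleGraph V} {u v : V}
    {n : ℕ} (H : Fin n → SimpleGraph V) (hle : ∀ i, H i ≤ G)
    (hdisj : Pairwise fun i j => Disjoint (H i) (H j)) (hreach : ∀ i, (H i).Reachable u v) :
    HasEdgeDisjointPaths G u v n := by
  choose p hp using fun i => (hreach i).exists_isPath
  refine ⟨fun i => ⟨(p i).mapLe (hle i), (hp i).mapLe (hle i)⟩, fun i j hij e hi hj => ?_⟩
  rw [SimpleGraph.Walk.edges_mapLe_eq_edges] at hi hj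
  exact Set.disjoint_left.mp (SimpleGraph.disjoint_edgeSet.mpr (hdisj hij))
    ((p i).edges_subset_edgeSet hi) ((p j).edges_subset_edgeSet hj)

/-- Let `G` be a finite simple graph and, for `i = 1, …, k`, let `F i` be a maximal spanning
forest of `G` minus the edges of the previous forests, and let `G' = F 1 ∪ ⋯ ∪ F k`.
If two vertices `u, v` are connected in the forest `F k`, then `G'` contains at least `k`
pairwise edge-disjoint `u`–`v` paths, i.e. `λ(u, v; G') ≥ k`. -/
theorem connected_in_last_forest_k_disjoint_paths {V : Type*} [Fintype V]
    (G : SimpleGraph V) (k : ℕ) (F : ℕ → SimpleGraph V)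
    (hF : ∀ i, 1 ≤ i → i ≤ k →
      IsMaximalSpanningForest (G \ (⨆ j ∈ Finset.Ico 1 i, F j)) (F i))
    (u v : V) (h : (F k).Reachable u v) :
    HasEdgeDisjointPaths (⨆ j ∈ Finset.Icc 1 k, F j) u v k := by
  have hreach : ∀ i, 1 ≤ i → i ≤ k → (F i).Reachable u v := by
    intro i hi hik
    rw [(hF i hi hik).reachable_eq]
    refine h.mono ((hF k (hi.trans hik) le_rfl).1.trans (sdiff_le_sdiff_left ?_))
    exact biSup_mono fun j hj => Finset.Ico_subset_Ico_right hik hj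
  have hdisj : ∀ i j, 1 ≤ i → i < j → j ≤ k → Disjoint (F i) (F j) := by
    intro i j hi hij hjk
    have hle : F i ≤ ⨆ l ∈ Finset.Ico 1 j, F l :=
      le_biSup F (Finset.mem_Ico.mpr ⟨hi, hij⟩)
    exact (disjoint_sdiff_self_right.mono_left hle).mono_right
      (hF j (hi.trans hij.le) hjk).1
  refine .of_pairwise_disjoint (fun i => F (i + 1))
    (fun i => le_biSup F (Finset.mem_Icc.mpr ⟨Nat.le_add_left 1 i, i.isLt⟩)) (fun i j hij => ?_)
    (fun i => hreach (i + 1) (by omega) i.isLt)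
  rcases lt_or_gt_of_ne hij with hlt | hlt
  · exact hdisj (i + 1) (j + 1) (by omega) (by omega) j.isLt
  · exact (hdisj (j + 1) (i + 1) (by omega) (by omega) i.isLt).symm
end

section
/- Let G' = (V, E) be a finite simple graph with distinct vertices u, v and an integer k ≥ 1 such that: (i) every cut of G' of cardinality strictly less than k separates u and v, and (ii) the minimum cardinality of a cut of G' separating u and v equals k − 1. Let u', v' ∈ V be vertices such that for every cut of G' of cardinality k − 1 separating u and v, the vertices u' and v' lie on opposite sides of the cut, and {u', v'} ∉ E. Then the graph G'' = G' ∪ {{u', v'}} obtained by adding the edge {u', v'} satisfies λ(G'') ≥ k, i.e., every cut of G'' has cardinality at least k. -/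
/-- The cardinality of the cut `(S, Sᶜ)` in the graph `G`: the number of edges of `G`
with one endpoint in `S` and the other in `Sᶜ`. -/
noncomputable def cutSize {V : Type*} (G : SimpleGraph V) (S : Set V) : ℕ :=
  {e ∈ G.edgeSet | ∃ x ∈ S, ∃ y ∈ Sᶜ, e = s(x, y)}.ncard

/-- The cut `(S, Sᶜ)` separates `u` and `v`: they lie on opposite sides of the partition. -/
def Separates {V : Type*} (S : Set V) (u v : V) : Prop :=
  (u ∈ S ∧ v ∉ S) ∨ (u ∉ S ∧ v ∈ S)

theorem cutSize_mono {V : Type*} [Finite V] {G H : SimpleGraph V} (h : G ≤ H) (S : Set V) :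
    cutSize G S ≤ cutSize H S :=
  Set.ncard_le_ncard (fun _ he => ⟨SimpleGraph.edgeSet_mono h he.1, he.2⟩) (Set.toFinite _)

theorem Separates.ne {V : Type*} {S : Set V} {x y : V} (h : Separates S x y) : x ≠ y := by
  rintro rfl
  rcases h with h | h
  · exact h.2 h.1
  · exact h.1 h.2

theorem Separates.exists_eq_mk {V : Type*} {S : Set V} {x y : V} (h : Separates S x y) :
    ∃ a ∈ S, ∃ b ∈ Sᶜ, s(x, y) = s(a, b) := by
  rcases h with h | h
  · exact ⟨x, h.1, y, h.2, rfl⟩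
  · exact ⟨y, h.2, x, h.1, Sym2.eq_swap⟩

/-- Adding a new edge across a cut strictly increases its cardinality. -/
theorem Separates.cutSize_lt_cutSize_sup {V : Type*} [Finite V] {G : SimpleGraph V} {S : Set V}
    {x y : V} (h : Separates S x y) (hadj : ¬ G.Adj x y) :
    cutSize G S < cutSize (G ⊔ SimpleGraph.fromEdgeSet {s(x, y)}) S := by
  refine Set.ncard_lt_ncard (Set.ssubset_iff_exists.mpr ⟨?_, s(x, y), ⟨?_, h.exists_eq_mk⟩, ?_⟩)
    (Set.toFinite _)
  · exact fun _ he => ⟨SimpleGraph.edgeSet_mono le_sup_left he.1, he.2⟩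
  · simp [h.ne]
  · exact fun he => hadj he.1

/-- Let `G'` be a finite simple graph with distinct vertices `u, v` and `k ≥ 1` such that
(i) every cut of cardinality `< k` separates `u` and `v`, and (ii) the minimum cardinality
of a cut separating `u` and `v` equals `k - 1`.  If `u', v'` are vertices lying on opposite
sides of every cut of cardinality `k - 1` separating `u` and `v`, and `{u', v'}` is not an
edge of `G'`, then adding the edge `{u', v'}` yields a graph `G''` with `λ(G'') ≥ k`:
every cut of `G''` has cardinality at least `k`. -/
theorem single_bridging_edge_restores_connectivity {V : Type*} [Fintype V]
    (G' : SimpleGraph V) (u v : V) (huv : u ≠ v) (k : ℕ) (hk : 1 ≤ k)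
    (hsep : ∀ S : Set V, S.Nonempty → Sᶜ.Nonempty → cutSize G' S < k → Separates S u v)
    (hmin₁ : ∃ S : Set V, S.Nonempty ∧ Sᶜ.Nonempty ∧ Separates S u v ∧
      cutSize G' S = k - 1)
    (hmin₂ : ∀ S : Set V, S.Nonempty → Sᶜ.Nonempty → Separates S u v →
      k - 1 ≤ cutSize G' S)
    (u' v' : V)
    (hcross : ∀ S : Set V, S.Nonempty → Sᶜ.Nonempty → Separates S u v →
      cutSize G' S = k - 1 → Separates S u' v')
    (hnotEdge : ¬ G'.Adj u' v') :
    ∀ S : Set V, S.Nonempty → Sᶜ.Nonempty →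
      k ≤ cutSize (G' ⊔ SimpleGraph.fromEdgeSet {s(u', v')}) S := by
  intro S hS hSc
  by_cases hlt : cutSize G' S < k
  · have huvS := hsep S hS hSc hlt
    have hle := hmin₂ S hS hSc huvS
    have hcut := (hcross S hS hSc huvS (by omega)).cutSize_lt_cutSize_sup hnotEdge
    omega
  · exact (not_lt.mp hlt).trans (cutSize_mono le_sup_left S)
end

section
/- Let G' = (V, E) be a finite simple graph with distinct vertices u, v and an integer k ≥ 1 such that: (i) every cut of G' of cardinality strictly less than k separates u and v, and (ii) the minimum cardinality of a cut of G' separating u and v equals k − 1. Let w ∈ V ∖ {u, v} be any vertex with {u, w} ∉ E and {w, v} ∉ E. Then the graph G'' obtained from G' by adding the two edges {u, w} and {w, v} satisfies λ(G'') ≥ k, i.e., every cut of G'' has cardinality at least k. -/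
theorem cutSize_lt_cutSize {V : Type*} [Finite V] {G H : SimpleGraph V} (h : G ≤ H) {S : Set V}
    {a b : V} (hH : H.Adj a b) (hG : ¬ G.Adj a b) (hS : Separates S a b) :
    cutSize G S < cutSize H S := by
  refine Set.ncard_lt_ncard ((Set.ssubset_iff_of_subset ?_).2
    ⟨s(a, b), ⟨hH, ?_⟩, fun he => hG he.1⟩) (Set.toFinite _)
  · exact fun _ he => ⟨SimpleGraph.edgeSet_mono h he.1, he.2⟩
  rcases hS with ⟨ha, hb⟩ | ⟨ha, hb⟩
  · exact ⟨a, ha, b, hb, rfl⟩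
  · exact ⟨b, hb, a, ha, Sym2.eq_swap⟩

theorem Separates.or_of_separates {V : Type*} {S : Set V} {u v : V} (h : Separates S u v) (w : V) :
    Separates S u w ∨ Separates S w v := by
  unfold Separates at *
  tauto

/-- Let `G'` be a finite simple graph with distinct vertices `u, v` and `k ≥ 1` such that
(i) every cut of cardinality `< k` separates `u` and `v`, and (ii) the minimum cardinality
of a cut separating `u` and `v` equals `k - 1`.  Let `w ∉ {u, v}` be any vertex with
`{u, w}` and `{w, v}` not edges of `G'`.  Then adding the two edges `{u, w}` and `{w, v}`
yields a graph `G''` with `λ(G'') ≥ k`: every cut of `G''` has cardinality at least `k`. -/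
theorem two_bridging_edges_restore_connectivity {V : Type*} [Fintype V]
    (G' : SimpleGraph V) (u v : V) (huv : u ≠ v) (k : ℕ) (hk : 1 ≤ k)
    (hsep : ∀ S : Set V, S.Nonempty → Sᶜ.Nonempty → cutSize G' S < k → Separates S u v)
    (hmin₁ : ∃ S : Set V, S.Nonempty ∧ Sᶜ.Nonempty ∧ Separates S u v ∧
      cutSize G' S = k - 1)
    (hmin₂ : ∀ S : Set V, S.Nonempty → Sᶜ.Nonempty → Separates S u v →
      k - 1 ≤ cutSize G' S)
    (w : V) (hwu : w ≠ u) (hwv : w ≠ v)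
    (hnotEdge₁ : ¬ G'.Adj u w) (hnotEdge₂ : ¬ G'.Adj w v) :
    ∀ S : Set V, S.Nonempty → Sᶜ.Nonempty →
      k ≤ cutSize (G' ⊔ SimpleGraph.fromEdgeSet {s(u, w), s(w, v)}) S := by
  intro S hS hSc
  by_cases hcut : k ≤ cutSize G' S
  · exact hcut.trans (cutSize_mono le_sup_left S)
  · have huvS := hsep S hS hSc (not_le.1 hcut)
    have hle := hmin₂ S hS hSc huvS
    suffices cutSize G' S <
        cutSize (G' ⊔ SimpleGraph.fromEdgeSet {s(u, w), s(w, v)}) S by omega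
    rcases huvS.or_of_separates w with hw | hw
    · exact cutSize_lt_cutSize le_sup_left (by simp [hwu.symm]) hnotEdge₁ hw
    · exact cutSize_lt_cutSize le_sup_left (by simp [hwv]) hnotEdge₂ hw
end
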